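/- Assume ∑_{i=1}^N ωᵢ M θ_{i3}/δᵢ > 1 and let b > 0 satisfy F(b) = 0. With Cᵢ = (M θ_{i3}/δᵢ)[(θ_{i1}+θ_{i3}) e^{θ_{i1} b} + (θ_{i2}−θ_{i3}) e^{−θ_{i2} b}]^{−1} and dᵢ = (M/δᵢ) e^{θ_{i3} b}(θ_{i1} e^{θ_{i1} b} + θ_{i2} e^{−θ_{i2} b})/[(θ_{i1}+θ_{i3}) e^{θ_{i1} b} + (θ_{i2}−θ_{i3}) e^{−θ_{i2} b}], the derivative of the equilibrium value function satisfies: ∑_{i=1}^N ωᵢ Cᵢ (θ_{i1} e^{θ_{i1} x} + θ_{i2} e^{−θ_{i2} x}) ≥ 1 for all x ∈ [0,b], with equality at x = b, and ∑_{i=1}^N ωᵢ dᵢ θ_{i3} e^{−θ_{i3} x} < 1 for all x > b. -/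

import Mathlib

open Real Finset

lemma tangent_aux (a b x : ℝ) : exp (a * b) * (1 + a * (x - b)) ≤ exp (a * x) := by
  have h : exp (a * x) = exp (a * b) * exp (a * (x - b)) := by
    rw [← Real.exp_add]; congr 1; ring
  rw [h]
  have := Real.add_one_le_exp (a * (x - b))
  have h2 := (Real.exp_pos (a * b)).le
  exact mul_le_mul_of_nonneg_left (by linarith) h2

lemma root_aux (s η c : ℝ) (hs : 0 < s) (hc : 0 < c) :
    0 < (η + √(η ^ 2 + 2 * s ^ 2 * c)) / s ^ 2 ∧
    s ^ 2 * ((η + √(η ^ 2 + 2 * s ^ 2 * c)) / s ^ 2) ^ 2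
      = 2 * η * ((η + √(η ^ 2 + 2 * s ^ 2 * c)) / s ^ 2) + 2 * c := by
  have h0 : 0 < 2 * s ^ 2 * c := by positivity
  have h1 := Real.sq_sqrt (show 0 ≤ η ^ 2 + 2 * s ^ 2 * c by positivity)
  have h2 : |η| < √(η ^ 2 + 2 * s ^ 2 * c) := by
    rw [← Real.sqrt_sq_eq_abs]
    exact Real.sqrt_lt_sqrt (sq_nonneg _) (by linarith)
  have h3 := neg_abs_le η
  refine ⟨div_pos (by linarith) (by positivity), ?_⟩
  generalize √(η ^ 2 + 2 * s ^ 2 * c) = r at *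
  field_simp
  linear_combination h1

theorem mixture_equilibrium_derivative_bounds
    (σ μ M : ℝ) (hσ : 0 < σ) (hμ : 0 < μ) (hM : 0 < M)
    (N : ℕ) (hN : 1 ≤ N) (δ ω θ1 θ2 θ3 : Fin N → ℝ)
    (hδ : ∀ i, 0 < δ i) (hω : ∀ i, 0 < ω i) (hωsum : ∑ i, ω i = 1)
    (hθ1 : ∀ i, θ1 i = (-μ + Real.sqrt (μ ^ 2 + 2 * σ ^ 2 * δ i)) / σ ^ 2)
    (hθ2 : ∀ i, θ2 i = (μ + Real.sqrt (μ ^ 2 + 2 * σ ^ 2 * δ i)) / σ ^ 2)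
    (hθ3 : ∀ i, θ3 i = ((μ - M) + Real.sqrt ((μ - M) ^ 2 + 2 * σ ^ 2 * δ i)) / σ ^ 2)
    (F : ℝ → ℝ)
    (hF : ∀ b, F b = (∑ i, ω i * (M * θ3 i / δ i) *
        (θ1 i * Real.exp (θ1 i * b) + θ2 i * Real.exp (-θ2 i * b)) /
        ((θ1 i + θ3 i) * Real.exp (θ1 i * b) + (θ2 i - θ3 i) * Real.exp (-θ2 i * b))) - 1)
    (hcond : 1 < ∑ i, ω i * (M * θ3 i / δ i))
    (b : ℝ) (hb : 0 < b) (hFb : F b = 0)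
    (C d : Fin N → ℝ)
    (hC : ∀ i, C i = (M * θ3 i / δ i) *
        ((θ1 i + θ3 i) * Real.exp (θ1 i * b) + (θ2 i - θ3 i) * Real.exp (-θ2 i * b))⁻¹)
    (hd : ∀ i, d i = (M / δ i) * Real.exp (θ3 i * b) *
        (θ1 i * Real.exp (θ1 i * b) + θ2 i * Real.exp (-θ2 i * b)) /
        ((θ1 i + θ3 i) * Real.exp (θ1 i * b) + (θ2 i - θ3 i) * Real.exp (-θ2 i * b)))
 :
    (∀ x ∈ Set.Icc (0 : ℝ) b,
      1 ≤ ∑ i, ω i * C i * (θ1 i * Real.exp (θ1 i * x) + θ2 i * Real.exp (-θ2 i * x))) ∧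
    (∑ i, ω i * C i * (θ1 i * Real.exp (θ1 i * b) + θ2 i * Real.exp (-θ2 i * b)) = 1) ∧
    (∀ x : ℝ, b < x → ∑ i, ω i * d i * θ3 i * Real.exp (-θ3 i * x) < 1) := by
  have p1 : ∀ i, 0 < θ1 i ∧ σ ^ 2 * θ1 i ^ 2 = -(2 * μ * θ1 i) + 2 * δ i := by
    intro i
    have := root_aux σ (-μ) (δ i) hσ (hδ i)
    rw [neg_sq, ← hθ1 i] at this
    exact ⟨this.1, by linarith [this.2]⟩
  have p2 : ∀ i, 0 < θ2 i ∧ σ ^ 2 * θ2 i ^ 2 = 2 * μ * θ2 i + 2 * δ i := by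
    intro i
    have := root_aux σ μ (δ i) hσ (hδ i)
    rwa [← hθ2 i] at this
  have p3 : ∀ i, 0 < θ3 i ∧ σ ^ 2 * θ3 i ^ 2 = 2 * (μ - M) * θ3 i + 2 * δ i := by
    intro i
    have := root_aux σ (μ - M) (δ i) hσ (hδ i)
    rwa [← hθ3 i] at this
  have hg : ∀ i, 0 < θ1 i * exp (θ1 i * b) + θ2 i * exp (-θ2 i * b) := by
    intro i
    have := (p1 i).1
    have := (p2 i).1
    positivity
  have hD : ∀ i, 0 < (θ1 i + θ3 i) * exp (θ1 i * b) + (θ2 i - θ3 i) * exp (-θ2 i * b) := by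
    intro i
    have h1 := (p1 i).1
    have h2 := (p2 i).1
    have h3 := (p3 i).1
    have h : exp (-θ2 i * b) ≤ exp (θ1 i * b) := by
      apply Real.exp_le_exp.mpr
      nlinarith
    nlinarith [hg i, mul_nonneg h3.le (sub_nonneg.mpr h)]
  have hCpos : ∀ i, 0 < C i := by
    intro i
    rw [hC]
    have := (p3 i).1
    have := hδ i
    have := hD i
    positivity
  have hS : ∑ i, ω i * C i * (θ1 i * exp (θ1 i * b) + θ2 i * exp (-θ2 i * b)) = 1 := by
    rw [hF] at hFb
    rw [← sub_eq_zero, ← hFb]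
    congr 1
    refine Finset.sum_congr rfl fun i _ => ?_
    rw [hC, div_eq_mul_inv _ (_ + _)]
    ring
  have key : ∀ i, C i * (θ1 i ^ 2 * exp (θ1 i * b) - θ2 i ^ 2 * exp (-θ2 i * b)) =
      -(C i * (θ1 i * exp (θ1 i * b) + θ2 i * exp (-θ2 i * b)) * θ3 i) +
      2 * M / σ ^ 2 * (1 - C i * (θ1 i * exp (θ1 i * b) + θ2 i * exp (-θ2 i * b))) := by
    intro i
    have hDi := (hD i).ne'
    have hδi := (hδ i).ne'
    have q1 := (p1 i).2
    have q2 := (p2 i).2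
    have q3 := (p3 i).2
    have hCD : C i * δ i * ((θ1 i + θ3 i) * exp (θ1 i * b) + (θ2 i - θ3 i) * exp (-θ2 i * b))
        = M * θ3 i := by
      rw [hC, mul_right_comm, inv_mul_cancel_right₀ hDi, div_mul_cancel₀ _ hδi]
    have h3 := (p3 i).1.ne'
    generalize exp (θ1 i * b) = e1 at *
    generalize exp (-θ2 i * b) = e2 at *
    field_simp
    apply mul_left_cancel₀ h3
    linear_combination C i * θ3 i * e1 * q1 - C i * θ3 i * e2 * q2 +
      C i * (θ1 i * e1 + θ2 i * e2) * q3 + 2 * hCD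
  refine ⟨?_, hS, ?_⟩
  · rintro x ⟨-, hx⟩
    calc (1 : ℝ) = ∑ i, (ω i * C i * (θ1 i * exp (θ1 i * b) + θ2 i * exp (-θ2 i * b)) +
          (x - b) * (2 * M / σ ^ 2) * (ω i -
            ω i * C i * (θ1 i * exp (θ1 i * b) + θ2 i * exp (-θ2 i * b)))) := by
          rw [Finset.sum_add_distrib, ← Finset.mul_sum, Finset.sum_sub_distrib, hS, hωsum]
          ring
      _ ≤ _ := by
          refine Finset.sum_le_sum fun i _ => ?_
          have t1 := mul_le_mul_of_nonneg_left (tangent_aux (θ1 i) b x) (p1 i).1.le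
          have t2 := mul_le_mul_of_nonneg_left (tangent_aux (-θ2 i) b x) (p2 i).1.le
          have t3 := mul_le_mul_of_nonneg_left (add_le_add t1 t2)
            (mul_pos (hω i) (hCpos i)).le
          refine le_trans ?_ t3
          have k : 0 ≤ (b - x) * (ω i *
              (C i * (θ1 i * exp (θ1 i * b) + θ2 i * exp (-θ2 i * b)) * θ3 i)) :=
            mul_nonneg (by linarith) (mul_pos (hω i)
              (mul_pos (mul_pos (hCpos i) (hg i)) (p3 i).1)).le
          have k2 := congrArg (fun z => ω i * (x - b) * z) (key i)
          linarith
  · intro x hx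
    rw [← hS]
    have : Nonempty (Fin N) := ⟨⟨0, hN⟩⟩
    refine Finset.sum_lt_sum_of_nonempty Finset.univ_nonempty fun i _ => ?_
    have he : exp (θ3 i * b) * exp (-θ3 i * x) < 1 := by
      rw [← Real.exp_add, Real.exp_lt_one_iff]
      nlinarith [(p3 i).1]
    have hpos := mul_pos (mul_pos (hω i) (hCpos i)) (hg i)
    have e : ω i * d i * θ3 i * exp (-θ3 i * x) =
        (ω i * C i * (θ1 i * exp (θ1 i * b) + θ2 i * exp (-θ2 i * b))) *
          (exp (θ3 i * b) * exp (-θ3 i * x)) := by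
      rw [hd, hC, div_eq_mul_inv _ (_ + _)]
      ring
    rw [e]
    exact mul_lt_of_lt_one_right hpos he
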